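/- Let U_q^+(sl_3) be the ℂ(q)-algebra presented by generators E_1, E_2 and the relations E_i²E_j − (q+q^{−1})E_iE_jE_i + E_jE_i² = 0 for {i,j}={1,2}, and let A be its n-fold tensor power algebra over ℂ(q) (n ≥ 1). For 1≤i≤n let E_{1,i}, E_{2,i} denote the images of E_1, E_2 in the i-th tensor factor, and set E_{12,i} = (q−q^{−1})^{−1}(E_{2,i}E_{1,i} − q^{−1}E_{1,i}E_{2,i}), E_{21,i} = (q−q^{−1})^{−1}(E_{1,i}E_{2,i} − q^{−1}E_{2,i}E_{1,i}), Y_{1,n} = E_{1,1}⋯E_{1,n}, Y_{2,n} = E_{2,1}⋯E_{2,n}. Define Z_{0,1}=E_{21,1}, Z_{1,1}=E_{12,1}, and inductively Z_{i,k} = Z_{i,k−1}E_{21,k} + Z_{i−1,k−1}E_{12,k} for 0≤i≤k (with Z_{i,k}=0 for i<0 or i>k). Then for all 0≤k,l≤n: Y_{1,n} Z_{k,n} = q^{n−2k} Z_{k,n} Y_{1,n}; Y_{2,n} Z_{k,n} = q^{−n+2k} Z_{k,n} Y_{2,n}; Z_{k,n} Z_{l,n} = Z_{l,n} Z_{k,n};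 Y_{1,n} Y_{2,n} = Σ_{k=0}^n q^{n−k} Z_{k,n}; and Y_{2,n} Y_{1,n} = Σ_{k=0}^n q^k Z_{k,n}. -/

import Mathlib

set_option synthInstance.maxHeartbeats 1000000
set_option maxHeartbeats 1000000

noncomputable section
open scoped TensorProduct

/-- The field `ℂ(q)` of rational functions. -/
abbrev Kq := RatFunc ℂ
/-- The variable `q`. -/
def qq : Kq := RatFunc.X

/-- The defining (quantum Serre) relations of `U_q^+(sl₃)` on the generators `E₁, E₂`
(indexed by `Fin 2`). -/
inductive SL3Rel : FreeAlgebra Kq (Fin 2) → FreeAlgebra Kq (Fin 2) → Prop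
  | serre (i j : Fin 2) : i ≠ j →
      SL3Rel (FreeAlgebra.ι Kq i * FreeAlgebra.ι Kq i * FreeAlgebra.ι Kq j
          + FreeAlgebra.ι Kq j * FreeAlgebra.ι Kq i * FreeAlgebra.ι Kq i)
        ((qq + qq⁻¹) • (FreeAlgebra.ι Kq i * FreeAlgebra.ι Kq j * FreeAlgebra.ι Kq i))

/-- `U_q^+(sl₃)`. -/
abbrev UqSL3 := RingQuot SL3Rel

/-- The generators `E₁, E₂` of `U_q^+(sl₃)`. -/
def Egen (i : Fin 2) : UqSL3 := RingQuot.mkAlgHom Kq SL3Rel (FreeAlgebra.ι Kq i)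

variable (n : ℕ)

/-- The `n`-fold tensor power algebra `U_q^+(sl₃)^{⊗n}`. -/
abbrev TP (n : ℕ) := ⨂[Kq] (_ : Fin n), UqSL3

/-- The image of `x ∈ U_q^+(sl₃)` in the `k`-th tensor factor (`1 ≤ k ≤ n`). -/
def emb (x : UqSL3) (k : ℕ) : TP n :=
  PiTensorProduct.tprod Kq (fun j : Fin n => if (j : ℕ) + 1 = k then x else 1)

/-- `E_{1,k}`. -/
def E1i (k : ℕ) : TP n := emb n (Egen 0) k
/-- `E_{2,k}`. -/
def E2i (k : ℕ) : TP n := emb n (Egen 1) k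
/-- `E_{12,k} = (q−q⁻¹)⁻¹ (E_{2,k}E_{1,k} − q⁻¹E_{1,k}E_{2,k})`. -/
def E12i (k : ℕ) : TP n := (qq - qq⁻¹)⁻¹ • (E2i n k * E1i n k - qq⁻¹ • (E1i n k * E2i n k))
/-- `E_{21,k} = (q−q⁻¹)⁻¹ (E_{1,k}E_{2,k} − q⁻¹E_{2,k}E_{1,k})`. -/
def E21i (k : ℕ) : TP n := (qq - qq⁻¹)⁻¹ • (E1i n k * E2i n k - qq⁻¹ • (E2i n k * E1i n k))

/-- `Y_{1,k} = E_{1,1} ⋯ E_{1,k}`. -/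
def Y1 : TP n := (List.ofFn fun j : Fin n => E1i n ((j : ℕ) + 1)).prod
/-- `Y_{2,k} = E_{2,1} ⋯ E_{2,k}`. -/
def Y2 : TP n := (List.ofFn fun j : Fin n => E2i n ((j : ℕ) + 1)).prod

/-- The elements `Z_{i,k}`, defined by `Z_{0,1} = E_{21,1}`, `Z_{1,1} = E_{12,1}` and the
recursion `Z_{i,k} = Z_{i,k−1}E_{21,k} + Z_{i−1,k−1}E_{12,k}` (`Z_{i,k} = 0` for `i < 0` or
`i > k`). -/
def Zel : ℕ → ℕ → TP n
  | _, 0 => 0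
  | 0, 1 => E21i n 1
  | 1, 1 => E12i n 1
  | _ + 2, 1 => 0
  | 0, k + 2 => Zel 0 (k + 1) * E21i n (k + 2)
  | i + 1, k + 2 => Zel (i + 1) (k + 1) * E21i n (k + 2) + Zel i (k + 1) * E12i n (k + 2)

/-! ### Abstract helper lemmas -/

section AbstractPart

variable {K A B : Type*} [Field K] [Ring A] [Algebra K A] [Ring B] [Algebra K B]

/-- Partial ordered products. -/
def gY (f : ℕ → A) : ℕ → A
  | 0 => 1
  | m + 1 => gY f m * f (m + 1)

/-- Normalised version of the `Z` elements. -/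
def gZ (u v : ℕ → A) : ℕ → ℕ → A
  | 0, 0 => 1
  | _ + 1, 0 => 0
  | 0, m + 1 => gZ u v 0 m * u (m + 1)
  | i + 1, m + 1 => gZ u v (i + 1) m * u (m + 1) + gZ u v i m * v (m + 1)

theorem ofFn_prod_eq_gY (f : ℕ → A) (m : ℕ) :
    (List.ofFn fun j : Fin m => f ((j : ℕ) + 1)).prod = gY f m := by
  induction m with
  | zero => simp [gY]
  | succ m ih =>
    rw [List.ofFn_succ', List.concat_eq_append, List.prod_append]
    simp [gY, ← ih]

theorem gY_comm (f : ℕ → A) (x : A) (m : ℕ) (h : ∀ j, 1 ≤ j → j ≤ m → Commute (f j) x) :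
    Commute (gY f m) x := by
  induction m with
  | zero => exact Commute.one_left x
  | succ m ih =>
    exact (ih fun j h1 h2 => h j h1 (by omega)).mul_left (h _ (by omega) le_rfl)

theorem gZ_comm (u v : ℕ → A) (x : A) (m : ℕ) (h : ∀ j, 1 ≤ j → j ≤ m → Commute (u j) x)
    (h' : ∀ j, 1 ≤ j → j ≤ m → Commute (v j) x) (i : ℕ) :
    Commute (gZ u v i m) x := by
  induction m generalizing i with
  | zero =>
    cases i with
    | zero => exact Commute.one_left x
    | succ i => exact Commute.zero_left x
  | succ m ih =>
    have ih' := ih (fun j h1 h2 => h j h1 (by omega)) (fun j h1 h2 => h' j h1 (by omega))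
    have hu := h (m + 1) (by omega) le_rfl
    have hv := h' (m + 1) (by omega) le_rfl
    cases i with
    | zero => exact (ih' 0).mul_left hu
    | succ i => exact ((ih' _).mul_left hu).add_left ((ih' _).mul_left hv)

theorem gZ_zero (u v : ℕ → A) (m i : ℕ) (h : m < i) : gZ u v i m = 0 := by
  induction m generalizing i with
  | zero =>
    cases i with
    | zero => omega
    | succ i => rfl
  | succ m ih =>
    cases i with
    | zero => omega
    | succ i => rw [gZ, ih _ (by omega), ih _ (by omega)]; simp

theorem qcomm_step (Y Z a u : A) (c d : K) (h1 : Y * Z = c • (Z * Y)) (h2 : a * u = d • (u * a))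
    (h3 : Commute Z a) (h4 : Commute Y u) : (Y * a) * (Z * u) = (c * d) • ((Z * u) * (Y * a)) := by
  calc (Y * a) * (Z * u) = Y * (a * Z) * u := by noncomm_ring
    _ = (Y * Z) * (a * u) := by rw [← h3.eq]; noncomm_ring
    _ = (c * d) • (Z * (Y * u) * a) := by
      rw [h1, h2, smul_mul_assoc, mul_smul_comm, smul_smul]; noncomm_ring
    _ = _ := by rw [h4.eq]; noncomm_ring

theorem gY_gZ (q : K) (hq : q ≠ 0) (e : ℤ) (a u v : ℕ → A) (m : ℕ)
    (hau : ∀ j, 1 ≤ j → j ≤ m → a j * u j = q ^ e • (u j * a j))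
    (hav : ∀ j, 1 ≤ j → j ≤ m → a j * v j = q ^ (-e) • (v j * a j))
    (cau : ∀ i j, 1 ≤ i → i ≤ m → 1 ≤ j → j ≤ m → i ≠ j → Commute (a i) (u j))
    (cav : ∀ i j, 1 ≤ i → i ≤ m → 1 ≤ j → j ≤ m → i ≠ j → Commute (a i) (v j)) (k : ℕ) :
    gY a m * gZ u v k m = q ^ (e * ((m : ℤ) - 2 * k)) • (gZ u v k m * gY a m) := by
  induction m generalizing k with
  | zero =>
    cases k with
    | zero => simp [gY, gZ]
    | succ k => simp [gY, gZ]
  | succ m ih =>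
    have ih' := ih (fun j h1 h2 => hau j h1 (by omega)) (fun j h1 h2 => hav j h1 (by omega))
      (fun i j h1 h2 h3 h4 => cau i j h1 (by omega) h3 (by omega))
      (fun i j h1 h2 h3 h4 => cav i j h1 (by omega) h3 (by omega))
    have hu := hau (m + 1) (by omega) le_rfl
    have hv := hav (m + 1) (by omega) le_rfl
    have hYu : Commute (gY a m) (u (m + 1)) := gY_comm _ _ _ fun j h1 h2 =>
      cau _ _ h1 (by omega) (by omega) le_rfl (by omega)
    have hYv : Commute (gY a m) (v (m + 1)) := gY_comm _ _ _ fun j h1 h2 =>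
      cav _ _ h1 (by omega) (by omega) le_rfl (by omega)
    have hZa : ∀ i, Commute (gZ u v i m) (a (m + 1)) := gZ_comm _ _ _ _
      (fun j h1 h2 => (cau _ _ (by omega) le_rfl h1 (by omega) (by omega)).symm)
      (fun j h1 h2 => (cav _ _ (by omega) le_rfl h1 (by omega) (by omega)).symm)
    have key1 := fun i => qcomm_step _ _ _ _ _ _ (ih' i) hu (hZa i) hYu
    have key2 := fun i => qcomm_step _ _ _ _ _ _ (ih' i) hv (hZa i) hYv
    simp only [← zpow_add₀ hq] at key1 key2
    cases k with
    | zero =>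
      rw [gY, gZ, key1]
      congr 2; push_cast; ring
    | succ k =>
      rw [gY, gZ, mul_add, key1, key2, add_mul, smul_add]
      congr 3 <;> (push_cast; ring)

theorem gZ_gZ (u v : ℕ → A) (m : ℕ)
    (huv : ∀ j, 1 ≤ j → j ≤ m → Commute (u j) (v j))
    (cuu : ∀ i j, 1 ≤ i → i ≤ m → 1 ≤ j → j ≤ m → i ≠ j → Commute (u i) (u j))
    (cuv : ∀ i j, 1 ≤ i → i ≤ m → 1 ≤ j → j ≤ m → i ≠ j → Commute (u i) (v j))
    (cvv : ∀ i j, 1 ≤ i → i ≤ m → 1 ≤ j → j ≤ m → i ≠ j → Commute (v i) (v j)) (k l : ℕ) :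
    Commute (gZ u v k m) (gZ u v l m) := by
  have huv' : ∀ i j, 1 ≤ i → i ≤ m → 1 ≤ j → j ≤ m → Commute (u i) (v j) := by
    intro i j h1 h2 h3 h4
    by_cases h : i = j
    · subst h; exact huv i h1 h2
    · exact cuv i j h1 h2 h3 h4 h
  have huu' : ∀ i j, 1 ≤ i → i ≤ m → 1 ≤ j → j ≤ m → Commute (u i) (u j) := by
    intro i j h1 h2 h3 h4
    by_cases h : i = j
    · subst h; exact Commute.refl _
    · exact cuu i j h1 h2 h3 h4 h
  have hvv' : ∀ i j, 1 ≤ i → i ≤ m → 1 ≤ j → j ≤ m → Commute (v i) (v j) := by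
    intro i j h1 h2 h3 h4
    by_cases h : i = j
    · subst h; exact Commute.refl _
    · exact cvv i j h1 h2 h3 h4 h
  refine gZ_comm _ _ _ _ (fun j h1 h2 => ?_) (fun j h1 h2 => ?_) _
  · exact (gZ_comm _ _ _ _ (fun i h3 h4 => huu' _ _ h3 h4 h1 h2)
      (fun i h3 h4 => (huv' _ _ h1 h2 h3 h4).symm) _).symm
  · exact (gZ_comm _ _ _ _ (fun i h3 h4 => huv' _ _ h3 h4 h1 h2)
      (fun i h3 h4 => hvv' _ _ h3 h4 h1 h2) _).symm

theorem gY_gY (a b : ℕ → A) (u v : ℕ → A) (s t : K) (m : ℕ)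
    (hab : ∀ j, 1 ≤ j → j ≤ m → a j * b j = s • u j + t • v j)
    (cab : ∀ i j, 1 ≤ i → i ≤ m → 1 ≤ j → j ≤ m → i ≠ j → Commute (a i) (b j)) :
    gY a m * gY b m = ∑ k ∈ Finset.range (m + 1), (s ^ (m - k) * t ^ k) • gZ u v k m := by
  induction m with
  | zero => simp [gY, gZ]
  | succ m ih =>
    have ih' := ih (fun j h1 h2 => hab j h1 (by omega))
      (fun i j h1 h2 h3 h4 => cab i j h1 (by omega) h3 (by omega))
    have hc : Commute (gY b m) (a (m + 1)) := gY_comm _ _ _ fun j h1 h2 =>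
      (cab _ _ (by omega) le_rfl h1 (by omega) (by omega)).symm
    have h0 : gY a (m + 1) * gY b (m + 1) = (gY a m * gY b m) * (a (m + 1) * b (m + 1)) := by
      rw [gY, gY]
      calc _ = gY a m * (a (m + 1) * gY b m) * b (m + 1) := by noncomm_ring
        _ = _ := by rw [← hc.eq]; noncomm_ring
    rw [h0, ih', hab _ (by omega) le_rfl, mul_add, Finset.sum_range_succ' _ (m + 1)]
    simp only [gZ, smul_add, Finset.sum_add_distrib]
    rw [add_right_comm]
    congr 1
    · have h1 : gZ u v (m + 1) m = 0 := gZ_zero _ _ _ _ (by omega)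
      rw [Finset.sum_range_succ _ m, Finset.sum_range_succ _ m, h1, zero_mul, smul_zero, add_zero,
        ← Finset.sum_range_succ _ m, Finset.sum_mul, Finset.sum_range_succ']
      congr 1
      · refine Finset.sum_congr rfl fun k hk => ?_
        rw [Finset.mem_range] at hk
        rw [smul_mul_smul_comm]
        congr 1
        rw [show m + 1 - (k + 1) = (m - (k + 1)) + 1 by omega, pow_succ]; ring
      · rw [smul_mul_smul_comm]; congr 1
        simp [pow_succ]
    · rw [Finset.sum_mul]
      refine Finset.sum_congr rfl fun k hk => ?_
      rw [smul_mul_smul_comm]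
      congr 1
      rw [show m + 1 - (k + 1) = m - k by omega, pow_succ]; ring

end AbstractPart

/-! ### The concrete algebra -/

theorem qq_ne_zero : qq ≠ 0 := RatFunc.X_ne_zero

theorem qq_sub_ne_zero : qq - qq⁻¹ ≠ 0 := by
  intro h
  have h2 : qq * qq = 1 := by
    have := sub_eq_zero.mp h
    nth_rewrite 2 [this]
    exact mul_inv_cancel₀ qq_ne_zero
  have h3 : (algebraMap (Polynomial ℂ) (RatFunc ℂ)) (Polynomial.X * Polynomial.X) =
      algebraMap (Polynomial ℂ) (RatFunc ℂ) 1 := by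
    rw [map_mul, RatFunc.algebraMap_X, map_one]; exact h2
  have h4 := RatFunc.algebraMap_injective ℂ h3
  have h5 := congrArg (Polynomial.eval 0) h4
  simp at h5

theorem serre_rel (i j : Fin 2) (h : i ≠ j) :
    Egen i * Egen i * Egen j + Egen j * Egen i * Egen i =
      (qq + qq⁻¹) • (Egen i * Egen j * Egen i) := by
  have := RingQuot.mkAlgHom_rel Kq (SL3Rel.serre i j h)
  simp only [map_add, map_mul, map_smul] at this
  exact this

/-- `E₁₂` / `E₂₁` in a single factor. -/
def Wgen (i j : Fin 2) : UqSL3 :=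
  (qq - qq⁻¹)⁻¹ • (Egen i * Egen j - qq⁻¹ • (Egen j * Egen i))

theorem Egen_Wgen (i j : Fin 2) (h : i ≠ j) :
    Egen i * Wgen i j = qq • (Wgen i j * Egen i) := by
  have hs := serre_rel i j h
  have hs' : Egen i * Egen i * Egen j =
      (qq + qq⁻¹) • (Egen i * Egen j * Egen i) - Egen j * Egen i * Egen i := by
    rw [← hs]; abel
  rw [Wgen, mul_smul_comm, smul_mul_assoc, smul_comm qq]
  congr 1
  rw [mul_sub, sub_mul, mul_smul_comm, smul_mul_assoc, smul_sub, smul_smul,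
    mul_inv_cancel₀ qq_ne_zero, one_smul, ← mul_assoc, ← mul_assoc, hs', add_smul]
  abel

theorem Egen_Wgen' (i j : Fin 2) (h : i ≠ j) :
    Egen i * Wgen j i = qq⁻¹ • (Wgen j i * Egen i) := by
  have hs := serre_rel i j h
  have hs' : Egen i * Egen i * Egen j =
      (qq + qq⁻¹) • (Egen i * Egen j * Egen i) - Egen j * Egen i * Egen i := by
    rw [← hs]; abel
  have hq := qq_ne_zero
  rw [Wgen, mul_smul_comm, smul_mul_assoc, smul_comm qq⁻¹]
  congr 1
  rw [mul_sub, sub_mul, mul_smul_comm, smul_mul_assoc, smul_sub,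
    ← mul_assoc, ← mul_assoc, hs', add_smul, smul_sub, smul_add, smul_smul,
    inv_mul_cancel₀ qq_ne_zero, one_smul]
  abel

theorem Egen_mul (i j : Fin 2) : Egen i * Egen j = qq • Wgen i j + Wgen j i := by
  have h := qq_sub_ne_zero
  have h' := qq_ne_zero
  rw [Wgen, Wgen, smul_comm qq, ← smul_add, smul_sub, smul_smul,
    mul_inv_cancel₀ qq_ne_zero, one_smul]
  rw [sub_add_sub_cancel, ← sub_smul, smul_smul, inv_mul_cancel₀ h, one_smul]

theorem Wgen_comm (i j : Fin 2) (h : i ≠ j) : Commute (Wgen i j) (Wgen j i) := by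
  have hi := Egen_Wgen i j h
  have hj := Egen_Wgen' j i h.symm
  have h1 : Commute (Wgen i j) (Egen j * Egen i) := by
    change _ = _
    rw [mul_assoc (Egen j), hi, mul_smul_comm, ← mul_assoc (Egen j), hj, smul_mul_assoc, smul_smul,
      mul_inv_cancel₀ qq_ne_zero, one_smul, mul_assoc]
  have h2 : Commute (Wgen i j) (Egen i * Egen j) := by
    change _ = _
    rw [mul_assoc (Egen i), hj, mul_smul_comm, ← mul_assoc (Egen i), hi, smul_mul_assoc, smul_smul,
      inv_mul_cancel₀ qq_ne_zero, one_smul, mul_assoc]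
  rw [Wgen.eq_def j i]
  exact (h1.sub_right (h2.smul_right _)).smul_right _

theorem emb_comm (n : ℕ) (x y : UqSL3) (i j : ℕ) (h : i ≠ j) :
    Commute (emb n x i) (emb n y j) := by
  change _ = _
  rw [emb, emb, PiTensorProduct.tprod_mul_tprod, PiTensorProduct.tprod_mul_tprod]
  congr 1
  funext t
  simp only [Pi.mul_apply]
  split_ifs <;> first | simp | omega

theorem emb_eq (n : ℕ) (k : ℕ) (h1 : 1 ≤ k) (h2 : k ≤ n) :
    ∃ φ : UqSL3 →ₐ[Kq] TP n, ∀ x, emb n x k = φ x := by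
  refine ⟨PiTensorProduct.singleAlgHom (R := Kq) (A := fun _ : Fin n => UqSL3) (⟨k - 1, by omega⟩ : Fin n), fun x => ?_⟩
  change _ = PiTensorProduct.tprod Kq
    (Pi.mulSingle (M := fun _ : Fin n => UqSL3) (⟨k - 1, by omega⟩ : Fin n) x)
  rw [emb]
  congr 1
  funext t
  by_cases h : (t : ℕ) + 1 = k
  · have : t = ⟨k - 1, by omega⟩ := Fin.ext (by simp; omega)
    rw [if_pos h, ← this, Pi.mulSingle_eq_same]
  · have : t ≠ ⟨k - 1, by omega⟩ := by
      intro ht; apply h; rw [ht]; simp; omega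
    simp [h, Pi.mulSingle_eq_of_ne this]

theorem E21i_eq (n k : ℕ) (h1 : 1 ≤ k) (h2 : k ≤ n) : E21i n k = emb n (Wgen 0 1) k := by
  obtain ⟨φ, hφ⟩ := emb_eq n k h1 h2
  simp only [E21i, E1i, E2i, hφ, Wgen, map_smul, map_sub, map_mul]

theorem E12i_eq (n k : ℕ) (h1 : 1 ≤ k) (h2 : k ≤ n) : E12i n k = emb n (Wgen 1 0) k := by
  obtain ⟨φ, hφ⟩ := emb_eq n k h1 h2
  simp only [E12i, E1i, E2i, hφ, Wgen, map_smul, map_sub, map_mul]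

theorem Zel_eq (n m k : ℕ) (h1 : m + 1 ≤ n) :
    Zel n k (m + 1) = gZ (emb n (Wgen 0 1)) (emb n (Wgen 1 0)) k (m + 1) := by
  induction m generalizing k with
  | zero =>
    match k with
    | 0 => simp [Zel, gZ, E21i_eq n 1 le_rfl h1]
    | 1 => simp [Zel, gZ, E12i_eq n 1 le_rfl h1]
    | k + 2 => simp [Zel, gZ]
  | succ m ih =>
    have e1 := E21i_eq n (m + 2) (by omega) h1
    have e2 := E12i_eq n (m + 2) (by omega) h1
    cases k with
    | zero => rw [Zel, gZ, ih _ (by omega), e1]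
    | succ k => rw [Zel, gZ, ih _ (by omega), ih _ (by omega), e1, e2]

/-- **Commutation relations for the diagonal folding `(sl₃^{×n}, sl₃)`**:
for all `0 ≤ k, l ≤ n`, `Y_{1,n}Z_{k,n} = q^{n−2k} Z_{k,n}Y_{1,n}`,
`Y_{2,n}Z_{k,n} = q^{−n+2k} Z_{k,n}Y_{2,n}`, `Z_{k,n}Z_{l,n} = Z_{l,n}Z_{k,n}`,
`Y_{1,n}Y_{2,n} = ∑_{k=0}^n q^{n−k} Z_{k,n}` and `Y_{2,n}Y_{1,n} = ∑_{k=0}^n q^k Z_{k,n}`. -/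
theorem diagonal_sl3_commutation (n : ℕ) (hn : 1 ≤ n) (k l : ℕ) (hk : k ≤ n) (hl : l ≤ n) :
    Y1 n * Zel n k n = qq ^ ((n : ℤ) - 2 * k) • (Zel n k n * Y1 n) ∧
    Y2 n * Zel n k n = qq ^ (-(n : ℤ) + 2 * k) • (Zel n k n * Y2 n) ∧
    Zel n k n * Zel n l n = Zel n l n * Zel n k n ∧
    Y1 n * Y2 n = ∑ k ∈ Finset.range (n + 1), qq ^ (n - k) • Zel n k n ∧
    Y2 n * Y1 n = ∑ k ∈ Finset.range (n + 1), qq ^ k • Zel n k n := by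
  have hq := qq_ne_zero
  have hZ : ∀ i, Zel n i n = gZ (emb n (Wgen 0 1)) (emb n (Wgen 1 0)) i n := by
    intro i
    obtain ⟨m, rfl⟩ := Nat.exists_eq_add_of_le' hn
    exact Zel_eq _ m i le_rfl
  have hY1 : Y1 n = gY (emb n (Egen 0)) n := ofFn_prod_eq_gY (emb n (Egen 0)) n
  have hY2 : Y2 n = gY (emb n (Egen 1)) n := ofFn_prod_eq_gY (emb n (Egen 1)) n
  have hc : ∀ x y : UqSL3, ∀ i j, 1 ≤ i → i ≤ n → 1 ≤ j → j ≤ n → i ≠ j →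
      Commute (emb n x i) (emb n y j) := fun x y i j _ _ _ _ h => emb_comm n x y i j h
  have hrel : ∀ (x y : UqSL3) (c : Kq), x * y = c • (y * x) → ∀ j, 1 ≤ j → j ≤ n →
      emb n x j * emb n y j = c • (emb n y j * emb n x j) := by
    intro x y c h j h1 h2
    obtain ⟨φ, hφ⟩ := emb_eq n j h1 h2
    simp only [hφ, ← map_mul, ← map_smul, h]
  have hprod : ∀ (i i' : Fin 2), ∀ j, 1 ≤ j → j ≤ n →
      emb n (Egen i) j * emb n (Egen i') j =
        qq • emb n (Wgen i i') j + (1 : Kq) • emb n (Wgen i' i) j := by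
    intro i i' j h1 h2
    obtain ⟨φ, hφ⟩ := emb_eq n j h1 h2
    simp only [hφ, ← map_mul, ← map_smul, ← map_add, Egen_mul, one_smul]
  have h01 : (0 : Fin 2) ≠ 1 := by decide
  simp only [hZ, hY1, hY2]
  refine ⟨?_, ?_, ?_, ?_, ?_⟩
  · have := gY_gZ qq hq 1 (emb n (Egen 0)) (emb n (Wgen 0 1)) (emb n (Wgen 1 0)) n
      (hrel (Egen 0) (Wgen 0 1) (qq ^ (1 : ℤ)) (by rw [zpow_one]; exact Egen_Wgen 0 1 h01))
      (hrel (Egen 0) (Wgen 1 0) (qq ^ (-1 : ℤ)) (by rw [zpow_neg_one]; exact Egen_Wgen' 0 1 h01))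
      (hc _ _) (hc _ _) k
    rwa [one_mul] at this
  · have := gY_gZ qq hq (-1) (emb n (Egen 1)) (emb n (Wgen 0 1)) (emb n (Wgen 1 0)) n
      (hrel (Egen 1) (Wgen 0 1) (qq ^ (-1 : ℤ))
        (by rw [zpow_neg_one]; exact Egen_Wgen' 1 0 h01.symm))
      (hrel (Egen 1) (Wgen 1 0) (qq ^ (-(-1) : ℤ))
        (by rw [neg_neg, zpow_one]; exact Egen_Wgen 1 0 h01.symm))
      (hc _ _) (hc _ _) k
    rwa [show (-1 : ℤ) * ((n : ℤ) - 2 * k) = -(n : ℤ) + 2 * k by ring] at this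
  · refine gZ_gZ _ _ n (fun j h1 h2 => ?_) (hc _ _) (hc _ _) (hc _ _) k l
    obtain ⟨φ, hφ⟩ := emb_eq n j h1 h2
    rw [hφ, hφ]
    exact (Wgen_comm 0 1 h01).map φ
  · have := gY_gY (emb n (Egen 0)) (emb n (Egen 1)) (emb n (Wgen 0 1)) (emb n (Wgen 1 0))
      qq 1 n (hprod 0 1) (hc _ _)
    simpa only [one_pow, mul_one] using this
  · have := gY_gY (emb n (Egen 1)) (emb n (Egen 0)) (emb n (Wgen 0 1)) (emb n (Wgen 1 0)) 1 qq n
      (fun j h1 h2 => by rw [hprod 1 0 j h1 h2, add_comm]) (hc _ _)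
    simpa only [one_pow, one_mul] using this

end
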